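/- arXiv:0912.0689 — 3 statements merged into one kernel-verified Lean document; each statement's English description precedes it below -/
import Mathlib

section
/- For any Z-grading g = ⊕_{j∈Z} g_j of a finite-dimensional semisimple Lie algebra g over an algebraically closed field of characteristic zero, there exists a semisimple element h ∈ g such that g_j = {x ∈ g | [h, x] = j·x} for all j ∈ Z. -/
open LieAlgebra

/-- For any ℤ-grading `g = ⊕ⱼ gⱼ` of a finite-dimensional semisimple Lie
algebra `g` over an algebraically closed field of characteristic zero, there exists a
semisimple element `h ∈ g` such that `gⱼ = {x | ⁅h, x⁆ = j • x}` for all `j`. -/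
theorem exists_grading_element
    (K : Type*) [Field K] [IsAlgClosed K] [CharZero K]
    (L : Type*) [LieRing L] [LieAlgebra K L]
    [Module.Finite K L] [LieAlgebra.IsSemisimple K L]
    (V : ℤ → Submodule K L)
    (hdecomp : DirectSum.IsInternal V)
    (hbracket : ∀ i j : ℤ, ∀ x ∈ V i, ∀ y ∈ V j, ⁅x, y⁆ ∈ V (i + j)) :
    ∃ h : L, (LieAlgebra.ad K L h).IsSemisimple ∧
      ∀ j : ℤ, ∀ x : L, x ∈ V j ↔ ⁅h, x⁆ = j • x := by
  classical
  have hfin : {i | V i ≠ ⊥}.Finite :=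
    WellFoundedGT.finite_ne_bot_of_iSupIndep hdecomp.submodule_iSupIndep
  let _ := hdecomp.chooseDecomposition
  let D : L →ₗ[K] L := (DirectSum.toModule K ℤ L fun j => (j : K) • (V j).subtype) ∘ₗ
    (DirectSum.decomposeLinearEquiv V).toLinearMap
  have hD : ∀ j : ℤ, ∀ x ∈ V j, D x = (j : K) • x := by
    intro j x hx
    lift x to V j using hx
    simp only [D, LinearMap.comp_apply, LinearEquiv.coe_coe,
      DirectSum.decomposeLinearEquiv_apply_coe, DirectSum.toModule_lof]
    rfl
  have hder : ∀ x y : L, D ⁅x, y⁆ = ⁅x, D y⁆ - ⁅y, D x⁆ := by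
    intro x y
    induction x using DirectSum.Decomposition.inductionOn V with
    | zero => simp
    | add a b ha hb => simp only [add_lie, map_add, lie_add, ha, hb]; abel
    | @homogeneous i a =>
      induction y using DirectSum.Decomposition.inductionOn V with
      | zero => simp
      | add c d hc hd => simp only [add_lie, map_add, lie_add, hc, hd]; abel
      | @homogeneous j b =>
        rw [hD _ _ (hbracket i j a a.2 b b.2), hD _ _ a.2, hD _ _ b.2, lie_smul, lie_smul,
          ← lie_skew (a : L) (b : L), smul_neg, smul_neg, Int.cast_add, add_smul]
        abel
  have hcomp : ∀ (i : ℤ) (x : L),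
      (DirectSum.decompose V (D x) i : L) = (i : K) • (DirectSum.decompose V x i : L) := by
    intro i x
    induction x using DirectSum.Decomposition.inductionOn V with
    | zero => simp
    | add a b ha hb => simp [ha, hb]
    | @homogeneous j a =>
      rw [hD _ _ a.2, DirectSum.decompose_smul, DirectSum.smul_apply]
      by_cases hij : j = i
      · subst hij; simp
      · simp [DirectSum.of_eq_of_ne _ _ _ (Ne.symm hij)]
  obtain ⟨h, hh⟩ := LieDerivation.IsKilling.exists_eq_ad (R := K) (⟨D, hder⟩ : LieDerivation K L L)
  have had : LieAlgebra.ad K L h = D := by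
    rw [← LieDerivation.coe_ad_apply_eq_ad_apply h, hh]
  have hlie : ∀ x, ⁅h, x⁆ = D x := fun x => by rw [← had]; rfl
  refine ⟨h, ?_, ?_⟩
  · rw [had]
    let p : Polynomial K := ∏ i ∈ hfin.toFinset, (Polynomial.X - Polynomial.C (i : K))
    refine Module.End.isSemisimple_of_squarefree_aeval_eq_zero (p := p) ?_ ?_
    · apply Polynomial.Separable.squarefree
      rw [Polynomial.separable_prod_X_sub_C_iff']
      intro x _ y _ hxy
      exact_mod_cast hxy
    · ext x
      induction x using DirectSum.Decomposition.inductionOn V with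
      | zero => simp
      | add a b ha hb => simp_all
      | @homogeneous j a =>
        by_cases ha : (a : L) = 0
        · simp [ha]
        · have hev : Module.End.HasEigenvector D (j : K) (a : L) :=
            ⟨Module.End.mem_eigenspace_iff.2 (hD _ _ a.2), ha⟩
          rw [Module.End.aeval_apply_of_hasEigenvector hev, Polynomial.eval_prod,
            Finset.prod_eq_zero (i := j)]
          · simp
          · rw [Set.Finite.mem_toFinset]
            intro hb
            exact ha ((Submodule.eq_bot_iff _).1 hb _ a.2)
          · simp
  · intro j x
    rw [hlie, ← Int.cast_smul_eq_zsmul K]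
    refine ⟨hD j x, fun hx => ?_⟩
    have hz : ∀ i, i ≠ j → (DirectSum.decompose V x i : L) = 0 := by
      intro i hij
      have := hcomp i x
      rw [hx, DirectSum.decompose_smul, DirectSum.smul_apply] at this
      have h2 : ((j : K) - i) • (DirectSum.decompose V x i : L) = 0 := by
        rw [sub_smul, ← this]; simp
      refine (smul_eq_zero.1 h2).resolve_left fun h3 => hij ?_
      exact_mod_cast (sub_eq_zero.1 h3).symm
    rw [← DirectSum.sum_support_decompose V x]
    refine Submodule.sum_mem _ fun i _ => ?_
    by_cases hij : i = j
    · subst hij; exact Subtype.prop _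
    · rw [hz i hij]; exact Submodule.zero_mem _
end

section
/- Let g be a finite-dimensional semisimple Lie algebra over C with a good Z-grading g = ⊕_{j∈Z} g_j for a nonzero nilpotent element e ∈ g_2. Then there exist h ∈ g_0 and f ∈ g_{-2} such that {e, h, f} is an sl2-triple. -/
/-- If `[A,[A,B]] = 0` and `A` is nilpotent then `[A,B]` is nilpotent. -/
lemma gsl2_comm_nilpotent {R : Type*} [Ring R] [Algebra ℂ R] (A B C : R)
    (hC : C = A * B - B * A) (hAC : A * C = C * A) (hA : IsNilpotent A) : IsNilpotent C := by
  set δ : Module.End ℂ R := LinearMap.mulLeft ℂ A - LinearMap.mulRight ℂ A with hδ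
  have hδa : ∀ X, δ X = A * X - X * A := fun X => by simp [hδ]
  have hnil : IsNilpotent δ := by
    refine Commute.isNilpotent_sub (by apply LinearMap.commute_mulLeft_right) ?_ ?_
    · exact (LinearMap.isNilpotent_mulLeft_iff ℂ A).2 hA
    · exact (LinearMap.isNilpotent_mulRight_iff ℂ A).2 hA
  have hleib : ∀ X Y, δ (X * Y) = δ X * Y + X * δ Y := by
    intro X Y
    simp only [hδa]
    noncomm_ring
  have hB : δ B = C := by rw [hδa, hC]
  have hC0 : δ C = 0 := by rw [hδa, hAC, sub_self]
  have hk : ∀ (k : ℕ) (X : R),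
      (δ ^ (k+1)) (X * B) = (δ ^ (k+1)) X * B + ((k : ℂ) + 1) • ((δ ^ k) X * C) := by
    intro k
    induction k with
    | zero => intro X; simp [hleib, hB]
    | succ k ih =>
      intro X
      rw [pow_succ' δ (k+1), Module.End.mul_apply, ih, map_add, map_smul, hleib, hleib, hB, hC0,
        Module.End.mul_apply, pow_succ' δ k, Module.End.mul_apply, mul_zero, add_zero]
      push_cast
      module
  have hCp : ∀ n : ℕ, δ (C ^ n) = 0 := by
    intro n
    rw [hδa, (show Commute A C from hAC).pow_right n |>.eq, sub_self]
  have hmain : ∀ n : ℕ, (δ ^ n) (B ^ n) = (n.factorial : ℂ) • C ^ n := by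
    intro n
    induction n with
    | zero => simp
    | succ n ih =>
      rw [pow_succ B, hk, pow_succ' δ n, Module.End.mul_apply, ih, map_smul, hCp, smul_zero,
        zero_mul, zero_add, Nat.factorial_succ, smul_mul_assoc, smul_smul, ← pow_succ]
      push_cast
      rfl
  obtain ⟨n, hn⟩ := hnil
  refine ⟨n, ?_⟩
  have h := hmain n
  rw [hn, LinearMap.zero_apply] at h
  exact (smul_eq_zero.1 h.symm).resolve_left (by exact_mod_cast n.factorial_ne_zero)

/-- If `[A,[A,B]] = 0` and `A` is nilpotent then `tr (AB) = 0`. -/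
lemma gsl2_trace_zero {M : Type*} [AddCommGroup M] [Module ℂ M] [Module.Finite ℂ M]
    (A B C : Module.End ℂ M)
    (hC : C = A * B - B * A) (hAC : A * C = C * A) (hA : IsNilpotent A) :
    LinearMap.trace ℂ M (A * B) = 0 := by
  have hCn := gsl2_comm_nilpotent A B C hC hAC hA
  have hpow : ∀ r : ℕ, A ^ (r+1) * B = B * A ^ (r+1) + ((r : ℂ) + 1) • (C * A ^ r) := by
    intro r
    induction r with
    | zero => simp [hC]
    | succ r ih =>
      have hAB : A * B = B * A + C := by rw [hC]; abel
      rw [pow_succ' A (r+1), mul_assoc, ih, mul_add, mul_smul_comm, ← mul_assoc, hAB,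
        ← mul_assoc A C, hAC, mul_assoc C A, ← pow_succ', add_mul, mul_assoc B]
      push_cast
      module
  rw [Module.End.trace_eq_sum_roots_charpoly_of_splits (IsAlgClosed.splits _)]
  refine Multiset.sum_eq_zero ?_
  intro μ hμ
  have hev : (A * B).HasEigenvalue μ :=
    (Module.End.hasEigenvalue_iff_isRoot_charpoly _ _).2 (Polynomial.isRoot_of_mem_roots hμ)
  obtain ⟨x, hx⟩ := hev.exists_hasEigenvector
  have hex : ∃ r : ℕ, (A ^ r) x = 0 := by
    obtain ⟨n, hn⟩ := hA
    exact ⟨n, by rw [hn]; rfl⟩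
  classical
  have hr := Nat.find_spec hex
  have hmin := fun m => Nat.find_min hex (m := m)
  generalize Nat.find hex = r at hr hmin
  cases r with
  | zero => exact absurd (by simpa using hr) hx.2
  | succ r =>
    have hv := hmin r (Nat.lt_succ_self r)
    have h1 : (A ^ (r+1) * B) x = μ • (A ^ r) x := by
      rw [pow_succ, mul_assoc, Module.End.mul_apply, hx.apply_eq_smul, map_smul]
    rw [hpow, LinearMap.add_apply, Module.End.mul_apply, hr, map_zero, zero_add,
      LinearMap.smul_apply, Module.End.mul_apply] at h1
    have hr0 : (r : ℂ) + 1 ≠ 0 := by exact_mod_cast Nat.succ_ne_zero r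
    have h2 : C ((A ^ r) x) = (((r : ℂ) + 1)⁻¹ * μ) • (A ^ r) x := by
      rw [mul_smul, ← h1, smul_smul, inv_mul_cancel₀ hr0, one_smul]
    have h3 : C.HasEigenvalue (((r : ℂ) + 1)⁻¹ * μ) :=
      Module.End.hasEigenvalue_of_hasEigenvector
        ⟨Module.End.mem_eigenspace_iff.2 h2, hv⟩
    have h4 := (h3.isNilpotent_of_isNilpotent hCn).eq_zero
    exact (mul_eq_zero.1 h4).resolve_left (inv_ne_zero hr0)

/-- `e` lies in the image of `(ad e)^2`. -/
lemma gsl2_mem_range (L : Type*) [LieRing L] [LieAlgebra ℂ L]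
    [Module.Finite ℂ L] [LieAlgebra.IsSemisimple ℂ L] (e : L)
    (hnil : IsNilpotent (LieAlgebra.ad ℂ L e)) : ∃ f : L, ⁅e, ⁅e, f⁆⁆ = e := by
  have hK : (killingForm ℂ L).Nondegenerate := LieAlgebra.IsKilling.killingForm_nondegenerate ℂ L
  have hR : (killingForm ℂ L).IsRefl := (LieModule.traceForm_isSymm ℂ L L).isRefl
  set T : Module.End ℂ L := LieAlgebra.ad ℂ L e * LieAlgebra.ad ℂ L e with hT
  have key : e ∈ LinearMap.range T := by
    rw [← LinearMap.BilinForm.orthogonal_orthogonal hK hR (LinearMap.range T)]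
    rw [LinearMap.BilinForm.mem_orthogonal_iff]
    intro z hz
    rw [LinearMap.BilinForm.mem_orthogonal_iff] at hz
    have hTz : ⁅e, ⁅e, z⁆⁆ = 0 := by
      refine hK.1 _ fun y => ?_
      have h := hz (T y) ⟨y, rfl⟩
      have h' : killingForm ℂ L ⁅e, ⁅e, y⁆⁆ z = 0 := h
      rw [LieModule.traceForm_apply_lie_apply', LieModule.traceForm_apply_lie_apply', neg_neg,
        LieModule.traceForm_comm] at h'
      exact h'
    change killingForm ℂ L z e = 0
    rw [LieModule.traceForm_comm, killingForm_apply_apply]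
    refine gsl2_trace_zero (LieAlgebra.ad ℂ L e) (LieAlgebra.ad ℂ L z)
      (LieAlgebra.ad ℂ L ⁅e, z⁆) ?_ ?_ hnil
    · ext x
      change ⁅⁅e, z⁆, x⁆ = ⁅e, ⁅z, x⁆⁆ - ⁅z, ⁅e, x⁆⁆
      exact lie_lie e z x
    · ext x
      change ⁅e, ⁅⁅e, z⁆, x⁆⁆ = ⁅⁅e, z⁆, ⁅e, x⁆⁆
      rw [leibniz_lie, hTz, zero_lie, zero_add]
  obtain ⟨f, hf⟩ := key
  exact ⟨f, hf⟩

/-- For a good ℤ-grading of a finite-dimensional semisimple complex Lie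
algebra for a nonzero nilpotent `e ∈ g₂`, there exist `h ∈ g₀` and `f ∈ g₋₂` such that
`{e, h, f}` is an `sl₂`-triple. -/
theorem exists_graded_sl2_triple
    (L : Type*) [LieRing L] [LieAlgebra ℂ L]
    [Module.Finite ℂ L] [LieAlgebra.IsSemisimple ℂ L]
    (V : ℤ → Submodule ℂ L)
    (hdecomp : DirectSum.IsInternal V)
    (hbracket : ∀ i j : ℤ, ∀ x ∈ V i, ∀ y ∈ V j, ⁅x, y⁆ ∈ V (i + j))
    (e : L) (hne : e ≠ 0) (he : e ∈ V 2)
    (hnil : IsNilpotent (LieAlgebra.ad ℂ L e))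
    (hinj : ∀ j : ℤ, j ≤ -1 → ∀ x ∈ V j, ⁅e, x⁆ = 0 → x = 0)
    (hsurj : ∀ j : ℤ, -1 ≤ j → ∀ y ∈ V (j + 2), ∃ x ∈ V j, ⁅e, x⁆ = y) :
    ∃ h ∈ V 0, ∃ f ∈ V (-2 : ℤ),
      ⁅e, f⁆ = h ∧ ⁅h, e⁆ = (2 : ℂ) • e ∧ ⁅h, f⁆ = (-2 : ℂ) • f := by
  obtain ⟨g, hg⟩ := gsl2_mem_range L e hnil
  obtain ⟨f₀, hf₀, hef₀⟩ : ∃ f₀ ∈ V (-2), ⁅e, ⁅e, f₀⁆⁆ = e := by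
    have hgt : g ∈ V (-2) ⊔ ⨆ (j : ℤ) (_ : j ≠ -2), V j := by
      have : (⊤ : Submodule ℂ L) ≤ V (-2) ⊔ ⨆ (j : ℤ) (_ : j ≠ -2), V j := by
        rw [← hdecomp.submodule_iSup_eq_top]
        refine iSup_le fun j => ?_
        by_cases hj : j = -2
        · subst hj; exact le_sup_left
        · exact le_sup_of_le_right (le_iSup₂_of_le j hj le_rfl)
      exact this trivial
    obtain ⟨a, ha, b, hb, rfl⟩ := Submodule.mem_sup.1 hgt
    refine ⟨a, ha, ?_⟩
    have hTb : ⁅e, ⁅e, b⁆⁆ ∈ ⨆ (j : ℤ) (_ : j ≠ 2), V j := by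
      have hle : (⨆ (j : ℤ) (_ : j ≠ -2), V j) ≤
          (⨆ (j : ℤ) (_ : j ≠ 2), V j).comap (LieAlgebra.ad ℂ L e * LieAlgebra.ad ℂ L e) := by
        refine iSup₂_le fun j hj y hy => ?_
        have h1 := hbracket 2 _ e he _ (hbracket 2 j e he y hy)
        exact (le_iSup₂_of_le (f := fun (j : ℤ) (_ : j ≠ 2) => V j) (2 + (2 + j))
          (by omega) le_rfl) h1
      exact hle hb
    have hTa : ⁅e, ⁅e, a⁆⁆ ∈ V 2 := hbracket 2 _ e he _ (hbracket 2 (-2) e he a ha)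
    have hdis := hdecomp.submodule_iSupIndep 2
    rw [lie_add, lie_add] at hg
    have hz : e - ⁅e, ⁅e, a⁆⁆ = 0 := by
      refine Submodule.disjoint_def.1 hdis _ (Submodule.sub_mem _ he hTa) ?_
      have : e - ⁅e, ⁅e, a⁆⁆ = ⁅e, ⁅e, b⁆⁆ := by
        rw [sub_eq_iff_eq_add, add_comm]; exact hg.symm
      rw [this]; exact hTb
    exact (sub_eq_zero.1 hz).symm
  have hf : (-2 : ℂ) • f₀ ∈ V (-2) := Submodule.smul_mem _ _ hf₀
  generalize hfdef : (-2 : ℂ) • f₀ = f at hf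
  have hh : ⁅e, f⁆ ∈ V 0 := hbracket 2 (-2) e he f hf
  have hhe : ⁅⁅e, f⁆, e⁆ = (2 : ℂ) • e := by
    rw [← lie_skew, ← hfdef, lie_smul, lie_smul, hef₀]
    module
  refine ⟨_, hh, f, hf, rfl, hhe, ?_⟩
  have hmem : ⁅⁅e, f⁆, f⁆ + (2 : ℂ) • f ∈ V (-2) :=
    Submodule.add_mem _ (hbracket 0 (-2) _ hh f hf) (Submodule.smul_mem _ _ hf)
  have h0 := hinj (-2) (by norm_num) _ hmem (by
    rw [lie_add, leibniz_lie, ← lie_skew e, hhe, lie_self, lie_smul, neg_lie, smul_lie]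
    module)
  rw [eq_neg_of_add_eq_zero_left h0]
  module
end

section
/- Let g be a finite-dimensional semisimple Lie algebra over C with a good Z-grading for a nonzero nilpotent e ∈ g_2, and a Lagrangian subspace l ⊆ g_{-1} with respect to the symplectic form ⟨x,y⟩ = ([x,y]|e). Let m = l ⊕ ⊕_{j≤-2} g_j. Then dim m = (1/2) dim O_e, where O_e = {Ad(g)(e) : g ∈ G} is the adjoint orbit of e. -/
theorem aux_orth {L : Type*} [LieRing L] [LieAlgebra ℂ L] [Module.Finite ℂ L]
    (V : ℤ → Submodule ℂ L) (hdecomp : DirectSum.IsInternal V)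
    (hbracket : ∀ i j : ℤ, ∀ x ∈ V i, ∀ y ∈ V j, ⁅x, y⁆ ∈ V (i + j))
    (i j : ℤ) (hij : i + j ≠ 0) (x y : L) (hx : x ∈ V i) (hy : y ∈ V j) :
    killingForm ℂ L x y = 0 := by
  rw [killingForm_apply_apply]
  refine LinearMap.trace_eq_zero_of_mapsTo_ne hdecomp (fun k => k + (i + j)) (by grind) ?_
  intro k z hz
  have h := hbracket i (j + k) x hx _ (hbracket j k y hy z hz)
  rw [show k + (i + j) = i + (j + k) by ring]
  simpa using h

theorem aux_orthS {L : Type*} [LieRing L] [LieAlgebra ℂ L] [Module.Finite ℂ L]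
    (V : ℤ → Submodule ℂ L) (hdecomp : DirectSum.IsInternal V)
    (hbracket : ∀ i j : ℤ, ∀ x ∈ V i, ∀ y ∈ V j, ⁅x, y⁆ ∈ V (i + j))
    (s t : Set ℤ) (hst : ∀ i ∈ s, ∀ j ∈ t, i + j ≠ 0) (x y : L)
    (hx : x ∈ ⨆ j ∈ s, V j) (hy : y ∈ ⨆ j ∈ t, V j) :
    killingForm ℂ L x y = 0 := by
  have h1 : ∀ i ∈ s, ∀ u ∈ V i, killingForm ℂ L u y = 0 := by
    intro i hi u hu
    have : (⨆ j ∈ t, V j) ≤ LinearMap.ker (killingForm ℂ L u) :=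
      iSup₂_le fun j hj v hv => LinearMap.mem_ker.2
        (aux_orth V hdecomp hbracket i j (hst i hi j hj) u v hu hv)
    exact this hy
  have h2 : (⨆ j ∈ s, V j) ≤ LinearMap.ker ((killingForm ℂ L).flip y) :=
    iSup₂_le fun j hj v hv => LinearMap.mem_ker.2 (h1 j hj v hv)
  exact h2 hx

theorem aux_zero {L : Type*} [LieRing L] [LieAlgebra ℂ L] [Module.Finite ℂ L]
    [LieAlgebra.IsSemisimple ℂ L]
    (V : ℤ → Submodule ℂ L) (hdecomp : DirectSum.IsInternal V)
    (hbracket : ∀ i j : ℤ, ∀ x ∈ V i, ∀ y ∈ V j, ⁅x, y⁆ ∈ V (i + j))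
    (s t : Set ℤ) (hst : ∀ i ∈ s, -i ∈ t) (x : L)
    (hx : x ∈ ⨆ j ∈ s, V j) (h0 : ∀ y ∈ ⨆ j ∈ t, V j, killingForm ℂ L x y = 0) : x = 0 := by
  have hk : ∀ y, killingForm ℂ L x y = 0 := by
    have : (⊤ : Submodule ℂ L) ≤ LinearMap.ker (killingForm ℂ L x) := by
      rw [← hdecomp.submodule_iSup_eq_top]
      refine iSup_le fun j => ?_
      by_cases hj : j ∈ t
      · intro y hy
        exact LinearMap.mem_ker.2 (h0 y ((le_biSup V hj) hy))
      · intro y hy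
        refine LinearMap.mem_ker.2 (aux_orthS V hdecomp hbracket s {j} ?_ x y hx (by simpa using hy))
        intro i hi k hk h
        rw [Set.mem_singleton_iff] at hk
        apply hj
        have := hst i hi
        rwa [show -i = j by omega] at this
    exact fun y => this trivial
  have hker := LieAlgebra.IsKilling.ker_killingForm_eq_bot ℂ L
  have : x ∈ LinearMap.ker (killingForm ℂ L) := LinearMap.mem_ker.2 (LinearMap.ext hk)
  rwa [hker, Submodule.mem_bot] at this

theorem aux_le {L : Type*} [LieRing L] [LieAlgebra ℂ L] [Module.Finite ℂ L]
    [LieAlgebra.IsSemisimple ℂ L]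
    (V : ℤ → Submodule ℂ L) (hdecomp : DirectSum.IsInternal V)
    (hbracket : ∀ i j : ℤ, ∀ x ∈ V i, ∀ y ∈ V j, ⁅x, y⁆ ∈ V (i + j))
    (s t : Set ℤ) (hst : ∀ i ∈ s, -i ∈ t) :
    Module.finrank ℂ (⨆ j ∈ s, V j : Submodule ℂ L) ≤
      Module.finrank ℂ (⨆ j ∈ t, V j : Submodule ℂ L) := by
  rw [← Subspace.dual_finrank_eq (K := ℂ) (V := (⨆ j ∈ t, V j : Submodule ℂ L))]
  refine LinearMap.finrank_le_finrank_of_injective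
    (f := ((killingForm ℂ L).domRestrict₁₂ (⨆ j ∈ s, V j) (⨆ j ∈ t, V j))) ?_
  rw [injective_iff_map_eq_zero]
  intro x hx
  apply Subtype.ext
  refine aux_zero V hdecomp hbracket s t hst x x.2 fun y hy => ?_
  exact LinearMap.congr_fun hx ⟨y, hy⟩

theorem aux_sup {L : Type*} [AddCommGroup L] [Module ℂ L] [Module.Finite ℂ L]
    (p q : Submodule ℂ L) (h : Disjoint p q) :
    Module.finrank ℂ (p ⊔ q : Submodule ℂ L) = Module.finrank ℂ p + Module.finrank ℂ q := by
  have := Submodule.finrank_sup_add_finrank_inf_eq p q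
  rw [h.eq_bot] at this
  simpa using this

/-- For a good ℤ-grading of a finite-dimensional semisimple complex Lie
algebra for a nonzero nilpotent `e ∈ g₂`, and a Lagrangian subspace `l ⊆ g₋₁` for the
symplectic form `⟨x,y⟩ = B(⁅x,y⁆, e)`, the subalgebra `m = l ⊕ ⊕_{j ≤ -2} gⱼ`
satisfies `dim m = (1/2) dim O_e`.  Here the dimension of the adjoint orbit
`O_e = {Ad(g)(e)}` is its tangent-space dimension `dim [g, e] = dim (range (ad e))`
(equivalently `dim g − dim g_e`). -/
theorem dim_m_eq_half_dim_orbit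
    (L : Type*) [LieRing L] [LieAlgebra ℂ L]
    [Module.Finite ℂ L] [LieAlgebra.IsSemisimple ℂ L]
    (B : LinearMap.BilinForm ℂ L)
    (hB_nondeg : B.Nondegenerate)
    (hB_symm : ∀ x y : L, B x y = B y x)
    (hB_inv : ∀ x y z : L, B ⁅x, y⁆ z = B x ⁅y, z⁆)
    (V : ℤ → Submodule ℂ L)
    (hdecomp : DirectSum.IsInternal V)
    (hbracket : ∀ i j : ℤ, ∀ x ∈ V i, ∀ y ∈ V j, ⁅x, y⁆ ∈ V (i + j))
    (e : L) (hne : e ≠ 0) (he : e ∈ V 2)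
    (hnil : IsNilpotent (LieAlgebra.ad ℂ L e))
    (hinj : ∀ j : ℤ, j ≤ -1 → ∀ x ∈ V j, ⁅e, x⁆ = 0 → x = 0)
    (hsurj : ∀ j : ℤ, -1 ≤ j → ∀ y ∈ V (j + 2), ∃ x ∈ V j, ⁅e, x⁆ = y)
    (l : Submodule ℂ L) (hl : l ≤ V (-1 : ℤ))
    (hl_iso : ∀ x ∈ l, ∀ y ∈ l, B ⁅x, y⁆ e = 0)
    (hl_lagr : 2 * Module.finrank ℂ l = Module.finrank ℂ (V (-1 : ℤ))) :
    2 * Module.finrank ℂ (l ⊔ ⨆ j ∈ {j : ℤ | j ≤ -2}, V j : Submodule ℂ L) =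
      Module.finrank ℂ (LinearMap.range (LieAlgebra.ad ℂ L e)) := by
  have ind := hdecomp.submodule_iSupIndep
  set N : Submodule ℂ L := ⨆ j ∈ {j : ℤ | j ≤ -2}, V j with hN
  set P : Submodule ℂ L := ⨆ j ∈ {j : ℤ | 2 ≤ j}, V j with hP
  have hNP : Module.finrank ℂ N = Module.finrank ℂ P :=
    le_antisymm (aux_le V hdecomp hbracket _ _ (by intro i hi; simp at hi ⊢; omega))
      (aux_le V hdecomp hbracket _ _ (by intro i hi; simp at hi ⊢; omega))
  have hdis : Disjoint (V (-1)) N := by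
    have := ind.disjoint_biSup_biSup (s := {(-1 : ℤ)}) (t := {j : ℤ | j ≤ -2}) (by simp)
    rw [iSup_singleton] at this
    exact this
  have e1 := aux_sup l N (hdis.mono_left hl)
  have e2 := aux_sup (V (-1)) N hdis
  have hMs : (V (-1) ⊔ N) = ⨆ j ∈ {j : ℤ | j ≤ -1}, V j := by
    rw [show {j : ℤ | j ≤ -1} = {-1} ∪ {j : ℤ | j ≤ -2} by ext; simp; omega, iSup_union]
    simp [hN]
  set Q : Submodule ℂ L := ⨆ j ∈ {j : ℤ | 0 ≤ j}, V j with hQ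
  have hT : (V (-1) ⊔ N) ⊔ Q = ⊤ := by
    rw [hMs, hQ, ← iSup_union, ← hdecomp.submodule_iSup_eq_top,
      show {j : ℤ | j ≤ -1} ∪ {j : ℤ | 0 ≤ j} = Set.univ by ext; simp; omega]
    simp
  have hmap : ∀ k : ℤ, -1 ≤ k → (⨆ j ∈ {j : ℤ | k ≤ j}, V j).map (LieAlgebra.ad ℂ L e : L →ₗ[ℂ] L)
      = ⨆ j ∈ {j : ℤ | k + 2 ≤ j}, V j := by
    intro k hk
    apply le_antisymm
    · simp only [Submodule.map_iSup]
      refine iSup₂_le fun j hj => ?_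
      rintro _ ⟨x, hx, rfl⟩
      have h := hbracket 2 j e he x hx
      refine (le_biSup V (i := 2 + j) ?_) h
      simp at hj ⊢; omega
    · refine iSup₂_le fun j hj y hy => ?_
      simp at hj
      obtain ⟨x, hx, rfl⟩ := hsurj (j - 2) (by omega) y (by simpa using hy)
      exact ⟨x, (le_biSup V (i := j - 2) (by simp; omega)) hx, rfl⟩
  have hinjM : ∀ x ∈ V (-1) ⊔ N, ⁅e, x⁆ = 0 → x = 0 := by
    intro x hx h0
    rw [hMs] at hx
    refine aux_zero V hdecomp hbracket _ {j : ℤ | (-1) + 2 ≤ j}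
      (by intro i hi; simp at hi ⊢; omega) x hx fun y hy => ?_
    rw [← hmap (-1) le_rfl] at hy
    obtain ⟨z, -, rfl⟩ := hy
    have := LieModule.traceForm_apply_lie_apply ℂ L L x e z
    rw [← lie_skew, h0] at this
    simpa using this.symm
  have hr : LinearMap.range (LieAlgebra.ad ℂ L e : L →ₗ[ℂ] L) =
      (V (-1) ⊔ N).map (LieAlgebra.ad ℂ L e : L →ₗ[ℂ] L) ⊔ P := by
    have := hmap 0 (by omega)
    rw [zero_add] at this
    rw [LinearMap.range_eq_map, ← hT, Submodule.map_sup, this]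
  have hd2 : Disjoint ((V (-1) ⊔ N).map (LieAlgebra.ad ℂ L e : L →ₗ[ℂ] L)) P := by
    have := ind.disjoint_biSup_biSup (s := {j : ℤ | j ≤ 1}) (t := {j : ℤ | 2 ≤ j})
      (Set.disjoint_left.2 (by intro a h1 h2; simp at h1 h2; omega))
    refine this.mono_left ?_
    rw [hMs]
    simp only [Submodule.map_iSup]
    refine iSup₂_le fun j hj => ?_
    rintro _ ⟨x, hx, rfl⟩
    have h := hbracket 2 j e he x hx
    refine (le_biSup V (i := 2 + j) ?_) h
    simp at hj ⊢; omega
  have e3 : Module.finrank ℂ ((V (-1) ⊔ N).map (LieAlgebra.ad ℂ L e : L →ₗ[ℂ] L)) =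
      Module.finrank ℂ (V (-1) ⊔ N : Submodule ℂ L) := by
    rw [← LinearMap.range_domRestrict]
    apply LinearMap.finrank_range_of_inj
    rw [injective_iff_map_eq_zero]
    intro x hx
    exact Subtype.ext (hinjM x x.2 hx)
  rw [hr, aux_sup _ _ hd2, e3, e2, e1]
  omega
end
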